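/- arXiv:1301.3678 — 2 statements merged into one kernel-verified Lean document; each statement's English description precedes it below -/
import Mathlib

section
/- Under the standing assumptions, if additionally δ < 1/(8A0³) and a0 < 1/(8A0³), then for l ≥ k, α ∈ I_k and β ∈ I_l: (l,β) ⪯ (k,α) if and only if Q^l_β ⊂ Q^k_α; and (l,β) ⋠ (k,α) if and only if Q^l_β ∩ Q^k_α = ∅. -/
open MeasureTheory Set

/-- A space of homogeneous type: `ρ` is a quasi-metric with quasi-triangle constant `A0`
whose balls are open, and `μ` is a doubling (Borel) measure with doubling constant `A1`. -/
structure IsHomogeneous {X : Type*} [TopologicalSpace X] [MeasurableSpace X] [BorelSpace X]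
    (rho : X → X → ℝ) (mu : Measure X) (A0 A1 : ℝ) : Prop where
  nonempty : Nonempty X
  A0_ge_one : 1 ≤ A0
  A1_ge_one : 1 ≤ A1
  nonneg : ∀ x y, 0 ≤ rho x y
  eq_zero_iff : ∀ x y, rho x y = 0 ↔ x = y
  symm : ∀ x y, rho x y = rho y x
  triangle : ∀ x y z, rho x z ≤ A0 * rho x y + A0 * rho y z
  ball_open : ∀ x r, 0 < r → IsOpen {y | rho x y < r}
  measure_ball_pos : ∀ x r, 0 < r → 0 < mu {y | rho x y < r}
  measure_ball_lt_top : ∀ x r, 0 < r → mu {y | rho x y < r} < ⊤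
  doubling : ∀ x r, 0 < r →
    mu {y | rho x y < 2 * r} ≤ ENNReal.ofReal A1 * mu {y | rho x y < r}

/-- The standing assumptions: a space of homogeneous type together with, for each
generation `k : ℤ`, a maximal `δ^k`-separated family of centers `z k : ι k → X`, and a
partial order `le` on index pairs (`le k a l b` means `(k,a) ⪯ (l,b)`) satisfying
the tree-structure properties (a)–(d) of Christ's construction. -/
structure DyadicSystem {X : Type*} [TopologicalSpace X] [MeasurableSpace X] [BorelSpace X]
    (rho : X → X → ℝ) (mu : Measure X) (A0 A1 delta : ℝ) {I : ℤ → Type*}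
    (z : ∀ k, I k → X) (le : ∀ k, I k → ∀ l, I l → Prop) : Prop where
  homog : IsHomogeneous rho mu A0 A1
  delta_pos : 0 < delta
  delta_lt_one : delta < 1
  separated : ∀ k (a b : I k), a ≠ b → delta ^ k ≤ rho (z k a) (z k b)
  maximal : ∀ (k : ℤ) (x : X), ∃ a : I k, rho x (z k a) < delta ^ k
  le_refl : ∀ k (a : I k), le k a k a
  le_trans : ∀ k (a : I k) l (b : I l) m (c : I m), le k a l b → le l b m c → le k a m c
  le_antisymm : ∀ k (a b : I k), le k a k b → le k b k a → a = b
  le_gen : ∀ k (a : I k) l (b : I l), le k a l b → l ≤ k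
  exists_unique_ancestor : ∀ (k : ℤ) (a : I k) (l : ℤ), l ≤ k → ∃! b : I l, le k a l b
  le_close : ∀ (k : ℤ) (a : I k) (b : I (k - 1)),
    le k a (k - 1) b → rho (z k a) (z (k - 1) b) < delta ^ (k - 1)
  le_parent : ∀ (k : ℤ) (a : I k) (b : I (k - 1)),
    rho (z k a) (z (k - 1) b) < delta ^ (k - 1) / (2 * A0) → le k a (k - 1) b

/-- The dyadic cube `Q^k_α := ⋃_{(l,β) ⪯ (k,α)} B(z^l_β, a0 δ^l)`. -/
def dyadicCube {X : Type*} (rho : X → X → ℝ) (delta a0 : ℝ) {I : ℤ → Type*}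
    (z : ∀ k, I k → X) (le : ∀ k, I k → ∀ l, I l → Prop) (k : ℤ) (a : I k) : Set X :=
  ⋃ (l : ℤ) (b : I l) (_ : le l b k a), {y | rho (z l b) y < a0 * delta ^ l}


section helpers
variable {X : Type*} [TopologicalSpace X]
    [MeasurableSpace X] [BorelSpace X] {I : ℤ → Type*} {rho : X → X → ℝ} {mu : Measure X}
    {A0 A1 delta a0 : ℝ} {z : ∀ k, I k → X} {le : ∀ k, I k → ∀ l, I l → Prop}

/-- Centers stay close to their ancestors. -/
theorem chain_bound (hsys : DyadicSystem rho mu A0 A1 delta z le)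
    (hdelta : delta < 1 / (8 * A0 ^ 3)) (m : ℤ) (c : I m) (t : ℕ) :
    ∀ (j : ℤ) (e : I j), m = j + t → le m c j e →
      rho (z m c) (z j e) < 2 * A0 * delta ^ j := by
  have hA := hsys.homog.A0_ge_one
  have hd := hsys.delta_pos
  have h8 : delta * (8 * A0 ^ 3) < 1 := (lt_div_iff₀ (by positivity)).1 hdelta
  have hA3 : A0 ≤ A0 ^ 3 := le_self_pow₀ hA (by norm_num)
  have h2 : 2 * A0 * delta < 1 := by nlinarith
  induction t with
  | zero =>
    intro j e hm hle
    obtain rfl : m = j := by simpa using hm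
    have : c = e :=
      (hsys.exists_unique_ancestor m c m (le_refl _)).unique (hsys.le_refl m c) hle
    subst this
    rw [(hsys.homog.eq_zero_iff _ _).2 rfl]
    positivity
  | succ t ih =>
    intro j' e hm hle
    obtain ⟨j, rfl⟩ : ∃ j, j' = j - 1 := ⟨j' + 1, by ring⟩
    have hm' : m = j + t := by push_cast at hm; linarith
    obtain ⟨f, hf, -⟩ := hsys.exists_unique_ancestor m c j (by omega)
    obtain ⟨g, hg, -⟩ := hsys.exists_unique_ancestor j f (j - 1) (by omega)
    have hge : g = e := (hsys.exists_unique_ancestor m c (j - 1) (by omega)).unique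
      (hsys.le_trans _ _ _ _ _ _ hf hg) hle
    subst hge
    have h1 := ih j f hm' hf
    have h3 := hsys.le_close j f g hg
    have h4 := hsys.homog.triangle (z m c) (z j f) (z (j - 1) g)
    have h5 : delta ^ j = delta * delta ^ (j - 1) := by
      rw [zpow_sub_one₀ hd.ne']; field_simp
    rw [h5] at h1
    have hp : 0 < delta ^ (j - 1) := by positivity
    have hA0 : 0 < A0 := by linarith
    calc rho (z m c) (z (j - 1) g) ≤ _ := h4
      _ < A0 * (2 * A0 * (delta * delta ^ (j - 1))) + A0 * delta ^ (j - 1) := by gcongr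
      _ = A0 * ((2 * A0 * delta) * delta ^ (j - 1) + delta ^ (j - 1)) := by ring
      _ ≤ A0 * (1 * delta ^ (j - 1) + delta ^ (j - 1)) := by gcongr
      _ = _ := by ring

/-- If two small balls meet, the finer index is below the coarser one. -/
theorem le_of_balls_meet (hsys : DyadicSystem rho mu A0 A1 delta z le)
    (ha0 : 0 < a0) (hdelta : delta < 1 / (8 * A0 ^ 3)) (ha : a0 < 1 / (8 * A0 ^ 3))
    (m n : ℤ) (hnm : n ≤ m) (c : I m) (d : I n) (x : X)
    (hc : rho (z m c) x < a0 * delta ^ m) (hd' : rho (z n d) x < a0 * delta ^ n) :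
    le m c n d := by
  have hA := hsys.homog.A0_ge_one
  have hA0 : 0 < A0 := by linarith
  have hd := hsys.delta_pos
  have h8 : delta * (8 * A0 ^ 3) < 1 := (lt_div_iff₀ (by positivity)).1 hdelta
  have h8' : a0 * (8 * A0 ^ 3) < 1 := (lt_div_iff₀ (by positivity)).1 ha
  have hA3 : A0 ≤ A0 ^ 3 := le_self_pow₀ hA (by norm_num)
  have hmn : delta ^ m ≤ delta ^ n :=
    zpow_le_zpow_right_of_le_one₀ hd hsys.delta_lt_one.le hnm
  have hp : 0 < delta ^ n := by positivity
  have key : rho (z m c) (z n d) < 2 * A0 * a0 * delta ^ n := by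
    rw [hsys.homog.symm] at hd'
    calc rho (z m c) (z n d) ≤ _ := hsys.homog.triangle _ x _
      _ < A0 * (a0 * delta ^ m) + A0 * (a0 * delta ^ n) := by gcongr
      _ ≤ A0 * (a0 * delta ^ n) + A0 * (a0 * delta ^ n) := by gcongr
      _ = _ := by ring
  rcases hnm.eq_or_lt with rfl | hlt
  · by_cases hcd : c = d
    · subst hcd; exact hsys.le_refl _ _
    · exfalso
      have h1 := hsys.separated _ c d hcd
      have h2 : 2 * A0 * a0 < 1 := by nlinarith
      nlinarith
  · obtain ⟨j, rfl⟩ : ∃ j, n = j - 1 := ⟨n + 1, by ring⟩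
    obtain ⟨e, he, -⟩ := hsys.exists_unique_ancestor m c j (by omega)
    obtain ⟨t, ht⟩ := Int.le.dest (show j ≤ m by omega)
    have h1 := chain_bound hsys hdelta m c t j e ht.symm he
    refine hsys.le_trans _ _ _ _ _ _ he (hsys.le_parent j e d ?_)
    have h5 : delta ^ j = delta * delta ^ (j - 1) := by
      rw [zpow_sub_one₀ hd.ne']; field_simp
    rw [h5, hsys.homog.symm] at h1
    rw [lt_div_iff₀ (by positivity)]
    have h6 : rho (z j e) (z (j - 1) d) <
        2 * A0 ^ 2 * (delta + a0) * delta ^ (j - 1) := by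
      calc rho (z j e) (z (j - 1) d) ≤ _ := hsys.homog.triangle _ (z m c) _
        _ < A0 * (2 * A0 * (delta * delta ^ (j - 1)))
            + A0 * (2 * A0 * a0 * delta ^ (j - 1)) := by gcongr
        _ = _ := by ring
    calc rho (z j e) (z (j - 1) d) * (2 * A0)
        < 2 * A0 ^ 2 * (delta + a0) * delta ^ (j - 1) * (2 * A0) := by gcongr
      _ = (4 * A0 ^ 3 * (delta + a0)) * delta ^ (j - 1) := by ring
      _ ≤ 1 * delta ^ (j - 1) := by gcongr; linarith
      _ = _ := one_mul _

end helpers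

/-- Lemma 10: for `l ≥ k`, `(l,β) ⪯ (k,α) ↔ Q^l_β ⊆ Q^k_α` and
`(l,β) ⋠ (k,α) ↔ Q^l_β ∩ Q^k_α = ∅`. -/
theorem dyadicCube_le_iff_subset {X : Type*} [TopologicalSpace X]
    [MeasurableSpace X] [BorelSpace X] {I : ℤ → Type*} (rho : X → X → ℝ) (mu : Measure X)
    (A0 A1 delta a0 : ℝ) (z : ∀ k, I k → X) (le : ∀ k, I k → ∀ l, I l → Prop)
    (hsys : DyadicSystem rho mu A0 A1 delta z le)
    (ha0 : 0 < a0) (ha1 : a0 < 1)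
    (hdelta : delta < 1 / (8 * A0 ^ 3)) (ha : a0 < 1 / (8 * A0 ^ 3))
    (k l : ℤ) (hkl : k ≤ l) (a : I k) (b : I l) :
    (le l b k a ↔ dyadicCube rho delta a0 z le l b ⊆ dyadicCube rho delta a0 z le k a) ∧
    (¬ le l b k a ↔
      dyadicCube rho delta a0 z le l b ∩ dyadicCube rho delta a0 z le k a = ∅) := by
  have hcen : z l b ∈ dyadicCube rho delta a0 z le l b := by
    simp only [dyadicCube, mem_iUnion, mem_setOf_eq]
    refine ⟨l, b, hsys.le_refl l b, ?_⟩
    rw [(hsys.homog.eq_zero_iff _ _).2 rfl]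
    have := hsys.delta_pos
    positivity
  have hsub : le l b k a →
      dyadicCube rho delta a0 z le l b ⊆ dyadicCube rho delta a0 z le k a := by
    intro h x hx
    simp only [dyadicCube, mem_iUnion, mem_setOf_eq] at hx ⊢
    obtain ⟨m, c, hc, hx⟩ := hx
    exact ⟨m, c, hsys.le_trans _ _ _ _ _ _ hc h, hx⟩
  have hmeet : ∀ x, x ∈ dyadicCube rho delta a0 z le l b →
      x ∈ dyadicCube rho delta a0 z le k a → le l b k a := by
    intro x hx hy
    simp only [dyadicCube, mem_iUnion, mem_setOf_eq] at hx hy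
    obtain ⟨m, c, hc, hx⟩ := hx
    obtain ⟨n, d, hd, hy⟩ := hy
    obtain ⟨a', ha', -⟩ := hsys.exists_unique_ancestor l b k hkl
    have hca' := hsys.le_trans _ _ _ _ _ _ hc ha'
    have : a' = a := by
      rcases le_total n m with h | h
      · have h1 := le_of_balls_meet hsys ha0 hdelta ha m n h c d x hx hy
        exact (hsys.exists_unique_ancestor m c k (hsys.le_gen _ _ _ _ hca')).unique hca'
          (hsys.le_trans _ _ _ _ _ _ h1 hd)
      · have h1 := le_of_balls_meet hsys ha0 hdelta ha n m h d c x hy hx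
        exact (hsys.exists_unique_ancestor n d k (hsys.le_gen _ _ _ _ hd)).unique
          (hsys.le_trans _ _ _ _ _ _ h1 hca') hd
    exact this ▸ ha'
  refine ⟨⟨hsub, fun h => hmeet _ hcen (h hcen)⟩, fun h => ?_, fun h hle => ?_⟩
  · ext x
    simp only [mem_inter_iff, mem_empty_iff_false, iff_false]
    exact fun hx => h (hmeet x hx.1 hx.2)
  · have : z l b ∈ (∅ : Set X) := h ▸ ⟨hcen, hsub hle hcen⟩
    exact this
end

section
/- Under the standing assumptions, if additionally δ and a0 are smaller than 1/(8A0³), then there exists N0 ∈ ℕ depending only on A0, A1 and δ such that every dyadic cube Q^k_α has at most N0 children: #{β ∈ I_{k+1} : Q^{k+1}_β ⊂ Q^k_α} ≤ N0. -/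
open MeasureTheory Set

theorem dyadic_center_dist {X : Type} [TopologicalSpace X] [MeasurableSpace X] [BorelSpace X]
    {rho : X → X → ℝ} {mu : Measure X} {A0 A1 delta : ℝ} {I : ℤ → Type}
    {z : ∀ k, I k → X} {le : ∀ k, I k → ∀ l, I l → Prop}
    (h : DyadicSystem rho mu A0 A1 delta z le) (hd : 2 * A0 * delta ≤ 1) (n : ℕ) :
    ∀ (k l : ℤ), l = k + n → ∀ (a : I k) (b : I l), le l b k a →
      rho (z l b) (z k a) ≤ 2 * A0 * delta ^ k := by
  have hA0 := h.homog.A0_ge_one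
  have hdp := h.delta_pos
  induction n with
  | zero =>
    intro k l hl a b hle
    obtain rfl : l = k := by simpa using hl
    have hab : b = a :=
      (h.exists_unique_ancestor l b l (_root_.le_refl l)).unique (h.le_refl l b) hle
    subst hab
    rw [(h.homog.eq_zero_iff _ _).2 rfl]
    positivity
  | succ n ih =>
    intro k l hl a b hle
    obtain ⟨j, rfl⟩ : ∃ j, k = j - 1 := ⟨k + 1, by ring⟩
    have hlj : l = j + n := by push_cast at hl; linarith
    obtain ⟨c, hc, -⟩ := h.exists_unique_ancestor l b j (by omega)
    obtain ⟨a', ha', -⟩ := h.exists_unique_ancestor j c (j - 1) (by omega)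
    have haa : a' = a := (h.exists_unique_ancestor l b (j - 1) (by omega)).unique
      (h.le_trans _ _ _ _ _ _ hc ha') hle
    subst haa
    have h1 := ih j l hlj c b hc
    have h2 := h.le_close j c a' ha'
    have h3 := h.homog.triangle (z l b) (z j c) (z (j - 1) a')
    have hj : delta ^ j = delta * delta ^ (j - 1) := by
      rw [← zpow_one_add₀ hdp.ne']; congr 1; ring
    have hD : 0 < delta ^ (j - 1) := by positivity
    rw [hj] at h1
    generalize delta ^ (j - 1) = D at *
    have h4 : 2 * A0 * (delta * D) ≤ D := by nlinarith
    have h5 : A0 * rho (z l b) (z j c) ≤ A0 * D := by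
      apply mul_le_mul_of_nonneg_left _ (by linarith); linarith
    have h6 : A0 * rho (z j c) (z (j - 1) a') ≤ A0 * D := by
      apply mul_le_mul_of_nonneg_left _ (by linarith); linarith
    linarith

theorem doubling_iter {X : Type} [TopologicalSpace X] [MeasurableSpace X] [BorelSpace X]
    {rho : X → X → ℝ} {mu : Measure X} {A0 A1 : ℝ}
    (h : IsHomogeneous rho mu A0 A1) (x : X) (r : ℝ) (hr : 0 < r) (m : ℕ) :
    mu {y | rho x y < 2 ^ m * r} ≤ ENNReal.ofReal A1 ^ m * mu {y | rho x y < r} := by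
  induction m with
  | zero => simp
  | succ m ih =>
    have := h.doubling x (2 ^ m * r) (by positivity)
    calc mu {y | rho x y < 2 ^ (m + 1) * r} = mu {y | rho x y < 2 * (2 ^ m * r)} := by
          congr 1; ext y; simp only [mem_setOf_eq]; rw [pow_succ]; ring_nf
      _ ≤ _ := this
      _ ≤ ENNReal.ofReal A1 * (ENNReal.ofReal A1 ^ m * mu {y | rho x y < r}) := by gcongr
      _ = _ := by rw [pow_succ]; ring

/-- Separated points in a ball: cardinality bound. -/
theorem separated_card {X : Type} [TopologicalSpace X] [MeasurableSpace X] [BorelSpace X]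
    {rho : X → X → ℝ} {mu : Measure X} {A0 A1 delta : ℝ}
    (h : IsHomogeneous rho mu A0 A1) (hd0 : 0 < delta) (hd1 : delta < 1)
    (m : ℕ) (hm : 14 * A0 ^ 5 / delta ≤ 2 ^ m)
    {J : Type} (w : J → X) (x : X) (D : ℝ) (hD : 0 < D)
    (hsep : ∀ i j, i ≠ j → delta * D ≤ rho (w i) (w j)) (t : Finset J)
    (ht : ∀ i ∈ t, rho x (w i) ≤ 3 * A0 ^ 2 * D) :
    t.card ≤ ⌈A1 ^ m⌉₊ := by
  have hA0 := h.A0_ge_one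
  have hA1 := h.A1_ge_one
  have hA0p : 0 < A0 := by linarith
  set r : ℝ := delta * D / (2 * A0) with hrdef
  have hr : 0 < r := by positivity
  have hrA : 2 * A0 * r = delta * D := by rw [hrdef]; field_simp
  have hA2 : 1 ≤ A0 ^ 2 := one_le_pow₀ hA0
  have hrD : r ≤ A0 ^ 2 * D := by
    have : r ≤ 2 * A0 * r := by nlinarith
    nlinarith
  set M : ℝ := 4 * A0 ^ 3 * D with hM
  have hMp : 0 < M := by positivity
  have hsub1 : ∀ i ∈ t, {y | rho (w i) y < r} ⊆ {y | rho x y < M} := by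
    intro i hi y hy
    simp only [mem_setOf_eq] at hy ⊢
    calc rho x y ≤ A0 * rho x (w i) + A0 * rho (w i) y := h.triangle _ _ _
      _ < A0 * (3 * A0 ^ 2 * D) + A0 * (A0 ^ 2 * D) := by
        have := mul_le_mul_of_nonneg_left (ht i hi) hA0p.le
        have := mul_lt_mul_of_pos_left (hy.trans_le hrD) hA0p
        linarith
      _ = M := by rw [hM]; ring
  have hsub2 : ∀ i ∈ t, {y | rho x y < M} ⊆ {y | rho (w i) y < 2 ^ m * r} := by
    intro i hi y hy
    simp only [mem_setOf_eq] at hy ⊢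
    have hb : 7 * A0 ^ 4 * D ≤ 2 ^ m * r := by
      calc 7 * A0 ^ 4 * D = 14 * A0 ^ 5 / delta * r := by rw [hrdef]; field_simp; norm_num
        _ ≤ _ := by gcongr
    have h32 : A0 ^ 3 ≤ A0 ^ 4 := pow_le_pow_right₀ hA0 (by norm_num)
    calc rho (w i) y ≤ A0 * rho (w i) x + A0 * rho x y := h.triangle _ _ _
      _ < A0 * (3 * A0 ^ 2 * D) + A0 * M := by
        have := mul_le_mul_of_nonneg_left (ht i hi) hA0p.le
        have := mul_lt_mul_of_pos_left hy hA0p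
        rw [h.symm (w i) x]
        linarith
      _ = 3 * (A0 ^ 3 * D) + 4 * A0 ^ 4 * D := by rw [hM]; ring
      _ ≤ 7 * A0 ^ 4 * D := by
        have := mul_le_mul_of_nonneg_right h32 hD.le
        linarith
      _ ≤ _ := hb
  have hdisj : (t : Set J).PairwiseDisjoint (fun i => {y | rho (w i) y < r}) := by
    intro i _ j _ hij
    rw [Function.onFun, Set.disjoint_left]
    intro y hy hy'
    simp only [mem_setOf_eq] at hy hy'
    have h1 := h.triangle (w i) y (w j)
    rw [h.symm y (w j)] at h1
    have h2 := hsep i j hij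
    have := mul_lt_mul_of_pos_left hy hA0p
    have := mul_lt_mul_of_pos_left hy' hA0p
    linarith
  have hmeas : ∀ i ∈ t, MeasurableSet {y | rho (w i) y < r} :=
    fun i _ => (h.ball_open _ _ hr).measurableSet
  have hB0 := h.measure_ball_pos x M hMp
  have hBt := h.measure_ball_lt_top x M hMp
  have key : (t.card : ENNReal) * mu {y | rho x y < M} ≤
      ENNReal.ofReal A1 ^ m * mu {y | rho x y < M} := by
    calc (t.card : ENNReal) * mu {y | rho x y < M} = ∑ i ∈ t, mu {y | rho x y < M} := by
          simp
      _ ≤ ∑ i ∈ t, ENNReal.ofReal A1 ^ m * mu {y | rho (w i) y < r} :=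
          Finset.sum_le_sum fun i hi =>
            (measure_mono (hsub2 i hi)).trans (doubling_iter h (w i) r hr m)
      _ = ENNReal.ofReal A1 ^ m * mu (⋃ i ∈ t, {y | rho (w i) y < r}) := by
          rw [← Finset.mul_sum, measure_biUnion_finset hdisj hmeas]
      _ ≤ _ := by
          gcongr
          exact Set.iUnion₂_subset hsub1
  have key2 : (t.card : ENNReal) ≤ ENNReal.ofReal A1 ^ m :=
    (ENNReal.mul_le_mul_iff_left hB0.ne' hBt.ne).1 key
  rw [← ENNReal.ofReal_pow (by linarith), ← ENNReal.ofReal_natCast,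
    ENNReal.ofReal_le_ofReal_iff (by positivity)] at key2
  exact_mod_cast key2.trans (Nat.le_ceil _)

/-- Theorem 7(f): there is `N0`, depending only on `A0`, `A1` and `δ`, bounding the number
of children of every dyadic cube. -/
theorem dyadicCube_children_card_le (A0 A1 delta : ℝ) (hA0 : 1 ≤ A0) (hA1 : 1 ≤ A1)
    (hd0 : 0 < delta) (hd1 : delta < 1) (hdelta : delta < 1 / (8 * A0 ^ 3)) :
    ∃ N0 : ℕ, ∀ (X : Type) [TopologicalSpace X] [MeasurableSpace X] [BorelSpace X]
      (rho : X → X → ℝ) (mu : Measure X) (I : ℤ → Type) (z : ∀ k, I k → X)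
      (le : ∀ k, I k → ∀ l, I l → Prop) (a0 : ℝ),
      DyadicSystem rho mu A0 A1 delta z le →
      0 < a0 → a0 < 1 → a0 < 1 / (8 * A0 ^ 3) →
      ∀ (k : ℤ) (a : I k),
        {b : I (k + 1) |
          dyadicCube rho delta a0 z le (k + 1) b ⊆ dyadicCube rho delta a0 z le k a}.Finite ∧
        {b : I (k + 1) |
          dyadicCube rho delta a0 z le (k + 1) b ⊆ dyadicCube rho delta a0 z le k a}.ncard
          ≤ N0 := by
  obtain ⟨m, hm⟩ := pow_unbounded_of_one_lt (14 * A0 ^ 5 / delta) (one_lt_two)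
  refine ⟨⌈A1 ^ m⌉₊, ?_⟩
  intro X _ _ _ rho mu I z le a0 h ha0 ha1 _ k a
  have hA0p : 0 < A0 := by linarith
  have hd : 2 * A0 * delta ≤ 1 := by
    rw [lt_div_iff₀ (by positivity)] at hdelta
    have : A0 ≤ A0 ^ 3 := le_self_pow₀ hA0 (by norm_num)
    nlinarith
  have hD : 0 < delta ^ k := by positivity
  set S : Set (I (k + 1)) := {b : I (k + 1) |
    dyadicCube rho delta a0 z le (k + 1) b ⊆ dyadicCube rho delta a0 z le k a} with hS
  have hdist : ∀ b ∈ S, rho (z k a) (z (k + 1) b) ≤ 3 * A0 ^ 2 * delta ^ k := by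
    intro b hb
    have hmem : z (k + 1) b ∈ dyadicCube rho delta a0 z le (k + 1) b := by
      simp only [dyadicCube, mem_iUnion, mem_setOf_eq]
      refine ⟨k + 1, b, h.le_refl _ _, ?_⟩
      rw [(h.homog.eq_zero_iff _ _).2 rfl]
      positivity
    have hmem2 := hb hmem
    simp only [dyadicCube, mem_iUnion, mem_setOf_eq] at hmem2
    obtain ⟨l, c, hle, hc⟩ := hmem2
    have hkl := h.le_gen _ _ _ _ hle
    have h1 := dyadic_center_dist h hd (l - k).toNat k l (by omega) a c hle
    have h2 : delta ^ l ≤ delta ^ k := zpow_le_zpow_right_of_le_one₀ hd0 hd1.le hkl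
    have h3 : a0 * delta ^ l ≤ delta ^ k := by
      have : 0 < delta ^ l := by positivity
      nlinarith
    have h4 := h.homog.triangle (z k a) (z l c) (z (k + 1) b)
    rw [h.homog.symm (z k a) (z l c)] at h4
    have h5 := mul_le_mul_of_nonneg_left h1 hA0p.le
    have h6 := mul_le_mul_of_nonneg_left (hc.le.trans h3) hA0p.le
    have h7 : A0 * delta ^ k ≤ A0 ^ 2 * delta ^ k := by
      gcongr; exact le_self_pow₀ hA0 (by norm_num)
    linarith
  have hcard : ∀ t : Finset (I (k + 1)), (t : Set (I (k + 1))) ⊆ S →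
      t.card ≤ ⌈A1 ^ m⌉₊ := by
    intro t ht
    refine separated_card h.homog hd0 hd1 m hm.le (z (k + 1)) (z k a) (delta ^ k) hD ?_ t
      (fun i hi => hdist i (ht hi))
    intro i j hij
    have := h.separated (k + 1) i j hij
    rwa [zpow_add_one₀ hd0.ne', mul_comm] at this
  have hfin : S.Finite := by
    by_contra hinf
    obtain ⟨t, ht, htc⟩ := Set.Infinite.exists_subset_card_eq hinf (⌈A1 ^ m⌉₊ + 1)
    have := hcard t ht
    omega
  refine ⟨hfin, ?_⟩
  rw [Set.ncard_eq_toFinset_card S hfin]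
  exact hcard _ (by simp)
end
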